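/- Let q ∈ [2,∞). Assume additionally that there exist a constant K > 0 and a natural number N₀ ≥ 2 such that ⟨A(x)x, x⟩/‖x‖² + |C|_∞(x)² · Φ_A(x)⁻¹ + |⟨B̄(x), x⟩| · log‖x‖ ≤ K (‖x‖ · log‖x‖)² for Lebesgue-a.e. x with ‖x‖ > N₀. Then every C¹ function h : ℝ^d → ℝ with ∫_{ℝ^d} |h|^q dμ < ∞ that satisfies the weak resolvent identity vanishes identically on ℝ^d. -/

import Mathlib

open MeasureTheory Real
open scoped RealInnerProductSpace ENNReal

noncomputable section

/-- `⟨M v, w⟩` for a `d × d` matrix `M` and vectors `v, w ∈ ℝ^d`. -/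
def mdot {d : ℕ} (M : Matrix (Fin d) (Fin d) ℝ) (v w : EuclideanSpace ℝ (Fin d)) : ℝ :=
  ∑ i, ∑ j, M i j * v j * w i

/-- `|M|_∞ = max_{i,j} |m_ij|`. -/
def matSup {d : ℕ} (M : Matrix (Fin d) (Fin d) ℝ) : ℝ :=
  ⨆ i, ⨆ j, |M i j|

/-- `Φ_M = inf_{ξ ≠ 0} ⟨M ξ, ξ⟩ / ‖ξ‖²`. -/
def PhiA {d : ℕ} (M : Matrix (Fin d) (Fin d) ℝ) : ℝ :=
  ⨅ ξ : {ξ : EuclideanSpace ℝ (Fin d) // ξ ≠ 0}, mdot M ξ.1 ξ.1 / ‖ξ.1‖ ^ 2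

/-- `h` satisfies the weak resolvent identity:
`(1/2)∫ ⟨(A+C)∇u, ∇h⟩ dμ + ∫ ⟨B̄, ∇u⟩ h dμ + ∫ u h dμ = 0` for every compactly supported
Lipschitz `u`. -/
def WeakResolvent {d : ℕ} (μ : Measure (EuclideanSpace ℝ (Fin d)))
    (A C : EuclideanSpace ℝ (Fin d) → Matrix (Fin d) (Fin d) ℝ)
    (Bb : EuclideanSpace ℝ (Fin d) → EuclideanSpace ℝ (Fin d))
    (h : EuclideanSpace ℝ (Fin d) → ℝ) : Prop :=
  ∀ u : EuclideanSpace ℝ (Fin d) → ℝ,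
    (∃ K, LipschitzWith K u) → HasCompactSupport u →
    (1/2) * (∫ x, mdot (A x + C x) (gradient u x) (gradient h x) ∂μ)
      + (∫ x, ⟪Bb x, gradient u x⟫ * h x ∂μ)
      + (∫ x, u x * h x ∂μ) = 0


section Mdot

variable {d : ℕ}

lemma mdot_add_matrix (M N : Matrix (Fin d) (Fin d) ℝ) (v w : EuclideanSpace ℝ (Fin d)) :
    mdot (M + N) v w = mdot M v w + mdot N v w := by
  simp only [mdot, Matrix.add_apply, add_mul, Finset.sum_add_distrib]

lemma mdot_add_left (M : Matrix (Fin d) (Fin d) ℝ) (v v' w : EuclideanSpace ℝ (Fin d)) :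
    mdot M (v + v') w = mdot M v w + mdot M v' w := by
  simp only [mdot, PiLp.add_apply, mul_add, add_mul, Finset.sum_add_distrib]

lemma mdot_add_right (M : Matrix (Fin d) (Fin d) ℝ) (v w w' : EuclideanSpace ℝ (Fin d)) :
    mdot M v (w + w') = mdot M v w + mdot M v w' := by
  simp only [mdot, PiLp.add_apply, mul_add, Finset.sum_add_distrib]

lemma mdot_smul_left (M : Matrix (Fin d) (Fin d) ℝ) (c : ℝ) (v w : EuclideanSpace ℝ (Fin d)) :
    mdot M (c • v) w = c * mdot M v w := by
  simp only [mdot, PiLp.smul_apply, smul_eq_mul, Finset.mul_sum]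
  exact Finset.sum_congr rfl fun i _ => Finset.sum_congr rfl fun j _ => by ring

lemma mdot_smul_right (M : Matrix (Fin d) (Fin d) ℝ) (c : ℝ) (v w : EuclideanSpace ℝ (Fin d)) :
    mdot M v (c • w) = c * mdot M v w := by
  simp only [mdot, PiLp.smul_apply, smul_eq_mul, Finset.mul_sum]
  exact Finset.sum_congr rfl fun i _ => Finset.sum_congr rfl fun j _ => by ring

lemma mdot_transpose (M : Matrix (Fin d) (Fin d) ℝ) (v w : EuclideanSpace ℝ (Fin d)) :
    mdot M.transpose v w = mdot M w v := by
  simp only [mdot, Matrix.transpose_apply]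
  rw [Finset.sum_comm]
  exact Finset.sum_congr rfl fun i _ => Finset.sum_congr rfl fun j _ => by ring

lemma mdot_comm {M : Matrix (Fin d) (Fin d) ℝ} (hM : M.IsSymm)
    (v w : EuclideanSpace ℝ (Fin d)) : mdot M v w = mdot M w v := by
  rw [← mdot_transpose, hM.eq]

lemma mdot_self_eq_zero {M : Matrix (Fin d) (Fin d) ℝ} (hM : M.transpose = -M)
    (v : EuclideanSpace ℝ (Fin d)) : mdot M v v = 0 := by
  have h1 := mdot_transpose M v v
  have h2 : mdot (-M) v v = -mdot M v v := by
    simp only [mdot, Matrix.neg_apply, neg_mul, Finset.sum_neg_distrib]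
  rw [hM, h2] at h1
  linarith

lemma mdot_pos {M : Matrix (Fin d) (Fin d) ℝ} (hM : M.PosDef)
    {v : EuclideanSpace ℝ (Fin d)} (hv : v ≠ 0) : 0 < mdot M v v := by
  have hv' : v.ofLp ≠ 0 := fun h => hv ((WithLp.ofLp_eq_zero 2).1 h)
  have h : mdot M v v = dotProduct (star v.ofLp) (M.mulVec v.ofLp) := by
    simp only [mdot, dotProduct, Matrix.mulVec, star_trivial, Finset.mul_sum]
    exact Finset.sum_congr rfl fun i _ => Finset.sum_congr rfl fun j _ => by ring
  exact h ▸ hM.dotProduct_mulVec_pos hv'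

lemma mdot_nonneg {M : Matrix (Fin d) (Fin d) ℝ} (hM : M.PosDef)
    (v : EuclideanSpace ℝ (Fin d)) : 0 ≤ mdot M v v := by
  rcases eq_or_ne v 0 with rfl | hv
  · simp [mdot]
  · exact (mdot_pos hM hv).le

lemma continuous_mdot {X : Type*} [TopologicalSpace X]
    {M : X → Matrix (Fin d) (Fin d) ℝ} {v w : X → EuclideanSpace ℝ (Fin d)}
    (hM : ∀ i j, Continuous fun x => M x i j) (hv : Continuous v) (hw : Continuous w) :
    Continuous fun x => mdot (M x) (v x) (w x) := by
  unfold mdot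
  refine continuous_finsetSum _ fun i _ => continuous_finsetSum _ fun j _ => ?_
  have := hM i j
  fun_prop

lemma phiA_mul_norm_sq_le {M : Matrix (Fin d) (Fin d) ℝ} (hM : M.PosDef)
    (v : EuclideanSpace ℝ (Fin d)) : PhiA M * ‖v‖ ^ 2 ≤ mdot M v v := by
  rcases eq_or_ne v 0 with rfl | hv
  · simp [mdot]
  · have hv' : 0 < ‖v‖ ^ 2 := by positivity
    rw [← le_div_iff₀ hv']
    refine ciInf_le (f := fun ξ : {ξ : EuclideanSpace ℝ (Fin d) // ξ ≠ 0} =>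
      mdot M ξ.1 ξ.1 / ‖ξ.1‖ ^ 2) ⟨0, ?_⟩ ⟨v, hv⟩
    rintro _ ⟨ξ, rfl⟩
    exact div_nonneg (mdot_nonneg hM _) (by positivity)

lemma phiA_pos (hd : 0 < d) {M : Matrix (Fin d) (Fin d) ℝ} (hM : M.PosDef) : 0 < PhiA M := by
  have : Nonempty (Fin d) := ⟨⟨0, hd⟩⟩
  obtain ⟨e, he⟩ := exists_ne (0 : EuclideanSpace ℝ (Fin d))
  have hcont : Continuous fun v : EuclideanSpace ℝ (Fin d) => mdot M v v :=
    continuous_mdot (fun _ _ => continuous_const) continuous_id continuous_id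
  obtain ⟨v, hv, hmin⟩ := (isCompact_sphere (0 : EuclideanSpace ℝ (Fin d)) 1).exists_isMinOn
    (NormedSpace.sphere_nonempty.2 zero_le_one) hcont.continuousOn
  have hv0 : v ≠ 0 := ne_zero_of_mem_unit_sphere ⟨v, hv⟩
  have : Nonempty {ξ : EuclideanSpace ℝ (Fin d) // ξ ≠ 0} := ⟨⟨e, he⟩⟩
  refine (mdot_pos hM hv0).trans_le (le_ciInf fun ξ => ?_)
  have hξ : ‖ξ.1‖ ≠ 0 := norm_ne_zero_iff.2 ξ.2
  have hmem : (‖ξ.1‖⁻¹ • ξ.1) ∈ Metric.sphere (0 : EuclideanSpace ℝ (Fin d)) 1 := by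
    rw [mem_sphere_zero_iff_norm, norm_smul, norm_inv, norm_norm, inv_mul_cancel₀ hξ]
  have := isMinOn_iff.1 hmin _ hmem
  rw [mdot_smul_left, mdot_smul_right] at this
  convert this using 1
  field_simp

lemma abs_le_matSup (M : Matrix (Fin d) (Fin d) ℝ) (i j : Fin d) : |M i j| ≤ matSup M :=
  (le_ciSup (f := fun j => |M i j|) (Set.finite_range _).bddAbove j).trans
    (le_ciSup (f := fun i => ⨆ j, |M i j|) (Set.finite_range _).bddAbove i)

lemma abs_mdot_le (M : Matrix (Fin d) (Fin d) ℝ) (v w : EuclideanSpace ℝ (Fin d)) :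
    |mdot M v w| ≤ d ^ 2 * (matSup M * ‖v‖ * ‖w‖) := by
  have hterm : ∀ i j : Fin d, |M i j * v j * w i| ≤ matSup M * ‖v‖ * ‖w‖ := fun i j => by
    rw [abs_mul, abs_mul]
    have h1 := abs_le_matSup M i j
    have h2 : |v j| ≤ ‖v‖ := PiLp.norm_apply_le v j
    have h3 : |w i| ≤ ‖w‖ := PiLp.norm_apply_le w i
    have h0 : 0 ≤ matSup M := (abs_nonneg _).trans h1
    gcongr
  calc |mdot M v w| ≤ ∑ i, ∑ j, |M i j * v j * w i| :=
        (Finset.abs_sum_le_sum_abs _ _).trans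
          (Finset.sum_le_sum fun i _ => Finset.abs_sum_le_sum_abs _ _)
    _ ≤ ∑ _i : Fin d, ∑ _j : Fin d, matSup M * ‖v‖ * ‖w‖ :=
        Finset.sum_le_sum fun i _ => Finset.sum_le_sum fun j _ => hterm i j
    _ = d ^ 2 * (matSup M * ‖v‖ * ‖w‖) := by
        simp only [Finset.sum_const, Finset.card_univ, Fintype.card_fin, nsmul_eq_mul]
        ring

/-- Young's inequality for the cross term of the energy estimate. -/
lemma energy_lower_bound (hd : 0 < d) {M N : Matrix (Fin d) (Fin d) ℝ} (hM : M.IsSymm)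
    (hMpos : M.PosDef) {w g : EuclideanSpace ℝ (Fin d)} {δ : ℝ}
    (h₁ : mdot M w w ≤ δ) (h₂ : matSup N ^ 2 * (PhiA M)⁻¹ * ‖w‖ ^ 2 ≤ δ) (a b : ℝ) :
    -((1 + d ^ 4) * δ * b ^ 2) ≤ 1 / 2 * a ^ 2 * mdot M g g + a * b * mdot (M + N) w g := by
  have hΦ := phiA_pos hd hMpos
  have hsq : 0 ≤ 1 / 4 * a ^ 2 * mdot M g g + a * b * mdot M w g + b ^ 2 * mdot M w w := by
    have := mdot_nonneg hMpos ((a / 2) • g + b • w)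
    simp only [mdot_add_left, mdot_add_right, mdot_smul_left, mdot_smul_right] at this
    rw [mdot_comm hM g w] at this
    linarith
  have hanti : 0 ≤ 1 / 4 * a ^ 2 * mdot M g g + a * b * mdot N w g + b ^ 2 * (d ^ 4 * δ) := by
    have hN : |a * b * mdot N w g| ≤ |a| * |b| * (d ^ 2 * (matSup N * ‖w‖ * ‖g‖)) := by
      rw [abs_mul, abs_mul]
      gcongr
      exact abs_mdot_le N w g
    have hg := mul_le_mul_of_nonneg_left (phiA_mul_norm_sq_le hMpos g)
      (by positivity : 0 ≤ 1 / 4 * a ^ 2)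
    have hδ := mul_le_mul_of_nonneg_left h₂ (by positivity : 0 ≤ b ^ 2 * (d : ℝ) ^ 4)
    have hcs := mul_nonneg hΦ.le
      (sq_nonneg (|a| * ‖g‖ / 2 - |b| * d ^ 2 * matSup N * ‖w‖ * (PhiA M)⁻¹))
    have hexp : PhiA M * (|a| * ‖g‖ / 2 - |b| * d ^ 2 * matSup N * ‖w‖ * (PhiA M)⁻¹) ^ 2
        = 1 / 4 * a ^ 2 * (PhiA M * ‖g‖ ^ 2) - |a| * |b| * (d ^ 2 * (matSup N * ‖w‖ * ‖g‖))
          + b ^ 2 * d ^ 4 * (matSup N ^ 2 * (PhiA M)⁻¹ * ‖w‖ ^ 2) := by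
      rw [← sq_abs a, ← sq_abs b]
      field_simp
      ring
    have := neg_le_of_abs_le hN
    linarith
  have hb := mul_le_mul_of_nonneg_left h₁ (sq_nonneg b)
  rw [mdot_add_matrix]
  linarith

end Mdot

section Calculus

variable {d : ℕ}

lemma exists_smooth_step : ∃ (S : ℝ → ℝ) (L : ℝ), ContDiff ℝ 1 S ∧ 0 ≤ L ∧
    (∀ t, 0 ≤ S t ∧ S t ≤ 1) ∧ (∀ t ≤ 1, S t = 1) ∧ (∀ t, 2 ≤ t → S t = 0) ∧
    (∀ t < 1, deriv S t = 0) ∧ ∀ t, |deriv S t| ≤ L := by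
  have hS : ContDiff ℝ 1 fun t : ℝ => Real.smoothTransition (2 - t) :=
    (Real.smoothTransition.contDiff (n := 1)).comp (contDiff_const.sub contDiff_id)
  have h1 : ∀ t < 1, deriv (fun t : ℝ => Real.smoothTransition (2 - t)) t = 0 := fun t ht => by
    have : (fun t : ℝ => Real.smoothTransition (2 - t)) =ᶠ[nhds t] fun _ => 1 := by
      filter_upwards [Iio_mem_nhds ht] with s hs
      exact Real.smoothTransition.one_of_one_le (by linarith [Set.mem_Iio.1 hs])
    rw [this.deriv_eq, deriv_const]
  have h2 : ∀ t > 2, deriv (fun t : ℝ => Real.smoothTransition (2 - t)) t = 0 := fun t ht => by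
    have : (fun t : ℝ => Real.smoothTransition (2 - t)) =ᶠ[nhds t] fun _ => 0 := by
      filter_upwards [Ioi_mem_nhds ht] with s hs
      exact Real.smoothTransition.zero_of_nonpos (by linarith [Set.mem_Ioi.1 hs])
    rw [this.deriv_eq, deriv_const]
  obtain ⟨L, hL⟩ := (isCompact_Icc (a := (1 : ℝ)) (b := 2)).exists_bound_of_continuousOn
    (hS.continuous_deriv le_rfl).continuousOn
  have hL0 : 0 ≤ L := (norm_nonneg _).trans (hL 1 (by norm_num))
  refine ⟨_, L, hS, hL0, fun t => ⟨Real.smoothTransition.nonneg _,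
    Real.smoothTransition.le_one _⟩,
    fun t ht => Real.smoothTransition.one_of_one_le (by linarith),
    fun t ht => Real.smoothTransition.zero_of_nonpos (by linarith), h1, fun t => ?_⟩
  rcases lt_or_ge t 1 with ht | ht
  · rw [h1 t ht, abs_zero]; exact hL0
  rcases lt_or_ge 2 t with ht' | ht'
  · rw [h2 t ht', abs_zero]; exact hL0
  · exact hL t ⟨ht, ht'⟩

lemma one_lt_log_three_add_sq (r : ℝ) : 1 < Real.log (3 + r ^ 2) := by
  rw [Real.lt_log_iff_exp_lt (by positivity)]
  nlinarith [Real.exp_one_lt_d9, sq_nonneg r]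

lemma hasGradientAt_loglog (x : EuclideanSpace ℝ (Fin d)) :
    HasGradientAt (fun x => Real.log (Real.log (3 + ‖x‖ ^ 2)))
      ((2 / ((3 + ‖x‖ ^ 2) * Real.log (3 + ‖x‖ ^ 2))) • x) x := by
  have h3 : 3 + ‖x‖ ^ 2 ≠ 0 := by positivity
  have hl : Real.log (3 + ‖x‖ ^ 2) ≠ 0 := by linarith [one_lt_log_three_add_sq ‖x‖]
  have := (((hasFDerivAt_id x).norm_sq.const_add 3).log h3).log hl
  rw [hasGradientAt_iff_hasFDerivAt]
  refine this.congr_fderiv ?_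
  ext v
  simp
  field_simp

lemma contDiff_loglog :
    ContDiff ℝ 1 fun x : EuclideanSpace ℝ (Fin d) => Real.log (Real.log (3 + ‖x‖ ^ 2)) :=
  ((contDiff_const.add (contDiff_norm_sq ℝ)).log fun x => by positivity).log
    fun x => by linarith [one_lt_log_three_add_sq ‖x‖]

/-- Radial cutoffs adapted to logarithmic growth, built from `log log`. -/
lemma exists_loglog_cutoff {R ε : ℝ} (hR : 2 ≤ R) (hε : 0 < ε) :
    ∃ φ s : EuclideanSpace ℝ (Fin d) → ℝ, ContDiff ℝ 1 φ ∧ HasCompactSupport φ ∧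
      (∀ x, 0 ≤ φ x ∧ φ x ≤ 1) ∧ (∀ x, ‖x‖ ≤ R → φ x = 1) ∧
      (∀ x, HasGradientAt φ (s x • x) x) ∧ (∀ x, ‖x‖ ≤ R → s x = 0) ∧
      ∀ x, R < ‖x‖ → |s x| * (‖x‖ ^ 2 * Real.log ‖x‖) ≤ ε := by
  obtain ⟨S, L, hS, hL, hS01, hS1, hS2, hdS, hdSL⟩ := exists_smooth_step
  set l : ℝ → ℝ := fun r => Real.log (Real.log (3 + r ^ 2)) with hl
  have hlpos : ∀ r, 0 < l r := fun r => Real.log_pos (one_lt_log_three_add_sq r)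
  have hlmono : ∀ r t, 0 ≤ r → r ≤ t → l r ≤ l t := fun r t hr hrt => by
    have := one_lt_log_three_add_sq r
    simp only [hl]
    gcongr
  set c : ℝ := min (ε / (L + 1)) (1 / (l R + 1))
  have hlR := hlpos R
  have hcpos : 0 < c := lt_min (by positivity) (by positivity)
  have hcε : L * c ≤ ε := by
    have : c ≤ ε / (L + 1) := min_le_left _ _
    rw [le_div_iff₀ (by positivity)] at this
    linarith
  have hcR : c * l R < 1 := by
    have : c ≤ 1 / (l R + 1) := min_le_right _ _
    rw [le_div_iff₀ (by positivity)] at this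
    linarith
  have hcr : ∀ x : EuclideanSpace ℝ (Fin d), ‖x‖ ≤ R → c * l ‖x‖ < 1 := fun x hx =>
    (mul_le_mul_of_nonneg_left (hlmono _ _ (norm_nonneg x) hx) hcpos.le).trans_lt hcR
  refine ⟨fun x => S (c * l ‖x‖),
    fun x => deriv S (c * l ‖x‖) * (c * (2 / ((3 + ‖x‖ ^ 2) * Real.log (3 + ‖x‖ ^ 2)))),
    hS.comp (contDiff_const.mul contDiff_loglog), ?_, fun x => hS01 _,
    fun x hx => hS1 _ (hcr x hx).le, fun x => ?_,
    fun x hx => mul_eq_zero_of_left (hdS _ (hcr x hx)) _, fun x hx => ?_⟩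
  · set T : ℝ := Real.exp (Real.exp (2 / c))
    refine HasCompactSupport.intro (isCompact_closedBall 0 T) fun x hx => hS2 _ ?_
    rw [mem_closedBall_zero_iff, not_le] at hx
    have hT0 : 0 < T := Real.exp_pos _
    have hTx : T ≤ 3 + ‖x‖ ^ 2 := by nlinarith [sq_nonneg (‖x‖ - 1)]
    have h1 : Real.exp (2 / c) ≤ Real.log (3 + ‖x‖ ^ 2) := by
      rwa [Real.le_log_iff_exp_le (by positivity)]
    have h2 : 2 / c ≤ l ‖x‖ := by
      rwa [hl, Real.le_log_iff_exp_le (by linarith [one_lt_log_three_add_sq ‖x‖])]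
    rwa [div_le_iff₀' hcpos] at h2
  · have hd := (hS.differentiable one_ne_zero (c * l ‖x‖)).hasDerivAt
    have h2 := (hasGradientAt_iff_hasFDerivAt.1 (hasGradientAt_loglog x)).const_mul c
    rw [hasGradientAt_iff_hasFDerivAt]
    refine (HasDerivAt.comp_hasFDerivAt x hd h2).congr_fderiv ?_
    simp only [map_smul, smul_smul]
  · have hx2 : 2 < ‖x‖ := hR.trans_lt hx
    have hlog : 0 < Real.log ‖x‖ := Real.log_pos (by linarith)
    have hlog2 : 2 * Real.log ‖x‖ ≤ Real.log (3 + ‖x‖ ^ 2) := by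
      rw [← Nat.cast_two, ← Real.log_pow]
      exact Real.log_le_log (by positivity) (by linarith)
    have h1 := one_lt_log_three_add_sq ‖x‖
    have hfrac : 2 / ((3 + ‖x‖ ^ 2) * Real.log (3 + ‖x‖ ^ 2)) * (‖x‖ ^ 2 * Real.log ‖x‖) ≤ 1 := by
      rw [div_mul_eq_mul_div, div_le_one (by positivity)]
      calc 2 * (‖x‖ ^ 2 * Real.log ‖x‖) = ‖x‖ ^ 2 * (2 * Real.log ‖x‖) := by ring
        _ ≤ (3 + ‖x‖ ^ 2) * Real.log (3 + ‖x‖ ^ 2) := by gcongr; linarith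
    have hnn : 0 ≤ 2 / ((3 + ‖x‖ ^ 2) * Real.log (3 + ‖x‖ ^ 2)) := by positivity
    rw [abs_mul, abs_of_nonneg (mul_nonneg hcpos.le hnn)]
    calc |deriv S (c * l ‖x‖)| * (c * (2 / ((3 + ‖x‖ ^ 2) * Real.log (3 + ‖x‖ ^ 2)))) *
          (‖x‖ ^ 2 * Real.log ‖x‖)
        = |deriv S (c * l ‖x‖)| * c * (2 / ((3 + ‖x‖ ^ 2) * Real.log (3 + ‖x‖ ^ 2)) *
          (‖x‖ ^ 2 * Real.log ‖x‖)) := by ring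
      _ ≤ L * c * 1 := by gcongr; exact hdSL _
      _ ≤ ε := by linarith

lemma abs_rpow_sub_two_mul_sq {q : ℝ} (hq : 2 ≤ q) (t : ℝ) : |t| ^ (q - 2) * t ^ 2 = |t| ^ q := by
  rcases eq_or_ne t 0 with rfl | ht
  · simp [Real.zero_rpow (by linarith : q ≠ 0)]
  · rw [← sq_abs, ← Real.rpow_natCast, ← Real.rpow_add (abs_pos.2 ht)]
    congr 1
    norm_num

lemma hasDerivAt_abs_rpow_mul {q : ℝ} (hq : 2 ≤ q) (t : ℝ) :
    HasDerivAt (fun t : ℝ => |t| ^ (q - 2) * t) ((q - 1) * |t| ^ (q - 2)) t := by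
  rcases eq_or_ne t 0 with rfl | ht
  · rcases hq.eq_or_lt with rfl | hq'
    · norm_num
      exact hasDerivAt_id (0 : ℝ)
    · rw [hasDerivAt_iff_tendsto_slope]
      have hcont : Continuous fun t : ℝ => |t| ^ (q - 2) :=
        continuous_abs.rpow_const fun _ => Or.inr (by linarith)
      have h0 : (q - 1) * |(0 : ℝ)| ^ (q - 2) = |(0 : ℝ)| ^ (q - 2) := by
        simp [Real.zero_rpow (by linarith : q - 2 ≠ 0)]
      rw [h0]
      refine ((hcont.tendsto 0).mono_left nhdsWithin_le_nhds).congr' ?_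
      filter_upwards [self_mem_nhdsWithin] with s hs
      have hs' : s ≠ 0 := hs
      simp [slope_def_field, hs']
  · have h1 : HasDerivAt (fun t : ℝ => |t| ^ (q - 2))
        (SignType.sign t * (q - 2) * |t| ^ (q - 2 - 1)) t :=
      (hasDerivAt_abs ht).rpow_const (Or.inl (abs_ne_zero.2 ht))
    refine (h1.mul (hasDerivAt_id t)).congr_deriv ?_
    have hs : (SignType.sign t : ℝ) * t = |t| := sign_mul_self t
    have hp : |t| ^ (q - 2 - 1) * |t| = |t| ^ (q - 2) := by
      rw [Real.rpow_sub_one (abs_ne_zero.2 ht), div_mul_cancel₀ _ (abs_ne_zero.2 ht)]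
    calc SignType.sign t * (q - 2) * |t| ^ (q - 2 - 1) * id t + |t| ^ (q - 2) * 1
        = (q - 2) * (|t| ^ (q - 2 - 1) * (SignType.sign t * t)) + |t| ^ (q - 2) := by
          simp only [id]; ring
      _ = (q - 1) * |t| ^ (q - 2) := by rw [hs, hp]; ring

lemma contDiff_abs_rpow_mul {q : ℝ} (hq : 2 ≤ q) :
    ContDiff ℝ 1 fun t : ℝ => |t| ^ (q - 2) * t := by
  refine contDiff_one_iff_deriv.2
    ⟨fun t => (hasDerivAt_abs_rpow_mul hq t).differentiableAt, ?_⟩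
  rw [funext fun t => (hasDerivAt_abs_rpow_mul hq t).deriv]
  exact continuous_const.mul (continuous_abs.rpow_const fun _ => Or.inr (by linarith))

variable {E : Type*} [NormedAddCommGroup E] [InnerProductSpace ℝ E] [CompleteSpace E]

lemma HasGradientAt.mul_real {f g : E → ℝ} {f' g' x : E} (hf : HasGradientAt f f' x)
    (hg : HasGradientAt g g' x) :
    HasGradientAt (fun y => f y * g y) (f x • g' + g x • f') x := by
  rw [hasGradientAt_iff_hasFDerivAt] at *
  exact (hf.mul hg).congr_fderiv (by simp only [map_add, map_smul])

lemma HasDerivAt.comp_hasGradientAt {k : ℝ → ℝ} {k' : ℝ} {f : E → ℝ} {f' x : E}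
    (hk : HasDerivAt k k' (f x)) (hf : HasGradientAt f f' x) :
    HasGradientAt (fun y => k (f y)) (k' • f') x := by
  rw [hasGradientAt_iff_hasFDerivAt] at *
  exact (HasDerivAt.comp_hasFDerivAt x hk hf).congr_fderiv (by simp only [map_smul])

lemma ContDiff.continuous_gradient {f : E → ℝ} (hf : ContDiff ℝ 1 f) : Continuous (gradient f) :=
  (InnerProductSpace.toDual ℝ E).symm.continuous.comp (hf.continuous_fderiv one_ne_zero)

lemma HasCompactSupport.gradient {f : E → ℝ} (hf : HasCompactSupport f) :
    HasCompactSupport (gradient f) :=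
  (hf.fderiv (𝕜 := ℝ)).comp_left (g := (InnerProductSpace.toDual ℝ E).symm) (map_zero _)

end Calculus

section Energy

variable {d : ℕ}

/-- The pointwise form of the energy estimate for the test function `φ² h |h|^(q-2)`, where
`P` stands for `|h|^(q-2)`, `b` for the drift, and `w`, `g` for the gradients of `φ`, `h`. -/
lemma integrand_lower_bound (hd : 0 < d) {M N : Matrix (Fin d) (Fin d) ℝ} (hM : M.IsSymm)
    (hMpos : M.PosDef) (hN : N.transpose = -N) {w g b U : EuclideanSpace ℝ (Fin d)}
    {δ δ' q φ η P : ℝ} (hq : 2 ≤ q) (hφ : 0 ≤ φ) (hφ1 : φ ≤ 1) (hP : 0 ≤ P)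
    (h₁ : mdot M w w ≤ δ) (h₂ : matSup N ^ 2 * (PhiA M)⁻¹ * ‖w‖ ^ 2 ≤ δ) (hb : |⟪b, w⟫| ≤ δ')
    (hU : U = (φ * φ) • (((q - 1) * P) • g) + (P * η) • (φ • w + φ • w)) :
    φ ^ 2 * (P * η ^ 2) - ((1 + d ^ 4) * δ + δ') * (P * η ^ 2) ≤
      1 / 2 * mdot (M + N) U g + ⟪b, U⟫ * η + φ * φ * (P * η) * η
        - (q - 1) / q * ⟪b, (φ * φ * (P * η)) • g + η • U⟫ := by
  have hNg : mdot (M + N) g g = mdot M g g := by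
    rw [mdot_add_matrix, mdot_self_eq_zero hN, add_zero]
  have hq0 : q ≠ 0 := by linarith
  have hrhs : 1 / 2 * mdot (M + N) U g + ⟪b, U⟫ * η + φ * φ * (P * η) * η
        - (q - 1) / q * ⟪b, (φ * φ * (P * η)) • g + η • U⟫
      = P * ((q - 1) / 2 * φ ^ 2 * mdot M g g + φ * η * mdot (M + N) w g
        + 2 / q * φ * η ^ 2 * ⟪b, w⟫ + φ ^ 2 * η ^ 2) := by
    rw [hU]
    simp only [mdot_add_left, mdot_smul_left, inner_add_right, inner_smul_right, hNg]
    field_simp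
    ring
  have hyoung := energy_lower_bound hd hM hMpos (g := g) h₁ h₂ φ η
  have hell : 1 / 2 * φ ^ 2 * mdot M g g ≤ (q - 1) / 2 * φ ^ 2 * mdot M g g := by
    have := mdot_nonneg hMpos g
    gcongr
    linarith
  have hdrift : -(δ' * η ^ 2) ≤ 2 / q * φ * η ^ 2 * ⟪b, w⟫ := by
    refine neg_le_of_abs_le ?_
    have h2q : 2 / q ≤ 1 := (div_le_one (by linarith)).2 hq
    have hc : 0 ≤ 2 / q := by positivity
    rw [abs_mul, abs_of_nonneg (by positivity : 0 ≤ 2 / q * φ * η ^ 2)]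
    calc 2 / q * φ * η ^ 2 * |⟪b, w⟫| ≤ 1 * 1 * η ^ 2 * δ' := by gcongr
      _ = δ' * η ^ 2 := by ring
  rw [hrhs]
  have := mul_le_mul_of_nonneg_left (by linarith :
    φ ^ 2 * η ^ 2 - ((1 + d ^ 4) * δ + δ') * η ^ 2 ≤
      (q - 1) / 2 * φ ^ 2 * mdot M g g + φ * η * mdot (M + N) w g
        + 2 / q * φ * η ^ 2 * ⟪b, w⟫ + φ ^ 2 * η ^ 2) hP
  linarith

lemma integrable_inner_of_hasCompactSupport {μ : Measure (EuclideanSpace ℝ (Fin d))}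
    {b V : EuclideanSpace ℝ (Fin d) → EuclideanSpace ℝ (Fin d)} (hb : Measurable b)
    (hbloc : LocallyIntegrable (fun x => ‖b x‖) μ) (hV : Continuous V)
    (hVs : HasCompactSupport V) : Integrable (fun x => ⟪b x, V x⟫) μ := by
  refine (hbloc.integrable_smul_left_of_hasCompactSupport hV.norm hVs.norm).mono'
    (hb.inner hV.measurable).aestronglyMeasurable (Filter.Eventually.of_forall fun x => ?_)
  rw [smul_eq_mul, mul_comm]
  exact norm_inner_le_norm _ _

/-- The growth bound controls a radial vector `w = s x` of size `s ≲ ε / (‖x‖² log ‖x‖)`. -/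
lemma growth_bounds (hd : 0 < d) {M N : Matrix (Fin d) (Fin d) ℝ} (hMpos : M.PosDef)
    {x b : EuclideanSpace ℝ (Fin d)} {s ε K : ℝ} (hK : 0 ≤ K) (hx : 1 < ‖x‖)
    (hs : |s| * (‖x‖ ^ 2 * Real.log ‖x‖) ≤ ε)
    (hgr : mdot M x x / ‖x‖ ^ 2 + matSup N ^ 2 * (PhiA M)⁻¹ + |⟪b, x⟫| * Real.log ‖x‖
      ≤ K * (‖x‖ * Real.log ‖x‖) ^ 2) :
    mdot M (s • x) (s • x) ≤ K * ε ^ 2 ∧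
      matSup N ^ 2 * (PhiA M)⁻¹ * ‖s • x‖ ^ 2 ≤ K * ε ^ 2 ∧ |⟪b, s • x⟫| ≤ K * ε := by
  have hlog : 0 < Real.log ‖x‖ := Real.log_pos hx
  have hx0 : 0 < ‖x‖ := by linarith
  have hA : 0 ≤ mdot M x x / ‖x‖ ^ 2 := div_nonneg (mdot_nonneg hMpos x) (by positivity)
  have hC : 0 ≤ matSup N ^ 2 * (PhiA M)⁻¹ :=
    mul_nonneg (sq_nonneg _) (inv_nonneg.2 (phiA_pos hd hMpos).le)
  have hB : 0 ≤ |⟪b, x⟫| * Real.log ‖x‖ := by positivity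
  have hsq : s ^ 2 * ‖x‖ ^ 2 * (K * (‖x‖ * Real.log ‖x‖) ^ 2) ≤ K * ε ^ 2 :=
    calc s ^ 2 * ‖x‖ ^ 2 * (K * (‖x‖ * Real.log ‖x‖) ^ 2)
        = K * (|s| * (‖x‖ ^ 2 * Real.log ‖x‖)) ^ 2 := by rw [← sq_abs s]; ring
      _ ≤ K * ε ^ 2 := by gcongr
  have hsx : 0 ≤ s ^ 2 * ‖x‖ ^ 2 := by positivity
  refine ⟨?_, ?_, ?_⟩
  · rw [mdot_smul_left, mdot_smul_right]
    calc s * (s * mdot M x x) = s ^ 2 * ‖x‖ ^ 2 * (mdot M x x / ‖x‖ ^ 2) := by field_simp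
      _ ≤ s ^ 2 * ‖x‖ ^ 2 * (K * (‖x‖ * Real.log ‖x‖) ^ 2) := mul_le_mul_of_nonneg_left (by linarith) hsx
      _ ≤ K * ε ^ 2 := hsq
  · rw [norm_smul, Real.norm_eq_abs, mul_pow, sq_abs]
    calc matSup N ^ 2 * (PhiA M)⁻¹ * (s ^ 2 * ‖x‖ ^ 2)
        = s ^ 2 * ‖x‖ ^ 2 * (matSup N ^ 2 * (PhiA M)⁻¹) := by ring
      _ ≤ s ^ 2 * ‖x‖ ^ 2 * (K * (‖x‖ * Real.log ‖x‖) ^ 2) := mul_le_mul_of_nonneg_left (by linarith) hsx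
      _ ≤ K * ε ^ 2 := hsq
  · rw [inner_smul_right, abs_mul]
    have hBx : |⟪b, x⟫| ≤ K * (‖x‖ ^ 2 * Real.log ‖x‖) := by
      refine le_of_mul_le_mul_right ?_ hlog
      linarith
    calc |s| * |⟪b, x⟫| ≤ |s| * (K * (‖x‖ ^ 2 * Real.log ‖x‖)) := by gcongr
      _ = K * (|s| * (‖x‖ ^ 2 * Real.log ‖x‖)) := by ring
      _ ≤ K * ε := by gcongr

/-- Caccioppoli-type estimate: testing the weak resolvent identity with `φ² h |h|^(q-2)`. -/
lemma integral_sq_mul_abs_rpow_le (hd : 0 < d) {μ : Measure (EuclideanSpace ℝ (Fin d))}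
    [IsLocallyFiniteMeasure μ] {A C : EuclideanSpace ℝ (Fin d) → Matrix (Fin d) (Fin d) ℝ}
    (hAc : ∀ i j, Continuous fun x => A x i j)
    (hAsymm : ∀ x, (A x).IsSymm) (hApos : ∀ x, (A x).PosDef)
    (hCc : ∀ i j, Continuous fun x => C x i j)
    (hCanti : ∀ x, (C x).transpose = -(C x))
    {Bb : EuclideanSpace ℝ (Fin d) → EuclideanSpace ℝ (Fin d)}
    (hBmeas : Measurable Bb) (hBloc : LocallyIntegrable (fun x => ‖Bb x‖) μ)
    (hBdiv : ∀ f : EuclideanSpace ℝ (Fin d) → ℝ, (∃ K, LipschitzWith K f) →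
      HasCompactSupport f → ∫ x, ⟪Bb x, gradient f x⟫ ∂μ = 0)
    {q : ℝ} (hq : 2 ≤ q) {h : EuclideanSpace ℝ (Fin d) → ℝ} (hh1 : ContDiff ℝ 1 h)
    (hhq : Integrable (fun x => |h x| ^ q) μ) (hres : WeakResolvent μ A C Bb h)
    {φ : EuclideanSpace ℝ (Fin d) → ℝ} (hφ : ContDiff ℝ 1 φ) (hφs : HasCompactSupport φ)
    (hφ01 : ∀ x, 0 ≤ φ x ∧ φ x ≤ 1) {w : EuclideanSpace ℝ (Fin d) → EuclideanSpace ℝ (Fin d)}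
    (hw : ∀ x, HasGradientAt φ (w x) x) {δ δ' : ℝ}
    (hbd : ∀ᵐ x ∂μ, mdot (A x) (w x) (w x) ≤ δ ∧
      matSup (C x) ^ 2 * (PhiA (A x))⁻¹ * ‖w x‖ ^ 2 ≤ δ ∧ |⟪Bb x, w x⟫| ≤ δ') :
    Integrable (fun x => φ x ^ 2 * |h x| ^ q) μ ∧
      ∫ x, φ x ^ 2 * |h x| ^ q ∂μ ≤ ((1 + d ^ 4) * δ + δ') * ∫ x, |h x| ^ q ∂μ := by
  set u : EuclideanSpace ℝ (Fin d) → ℝ := fun x => φ x * φ x * (|h x| ^ (q - 2) * h x)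
  have hu1 : ContDiff ℝ 1 u := (hφ.mul hφ).mul ((contDiff_abs_rpow_mul hq).comp hh1)
  have hus : HasCompactSupport u := (hφs.mul_right (f' := φ)).mul_right
  have hhg : ∀ x, HasGradientAt h (gradient h x) x := fun x =>
    (hh1.differentiable one_ne_zero x).hasGradientAt
  have hug : ∀ x, HasGradientAt u ((φ x * φ x) • (((q - 1) * |h x| ^ (q - 2)) • gradient h x)
      + (|h x| ^ (q - 2) * h x) • (φ x • w x + φ x • w x)) x := fun x =>
    ((hw x).mul_real (hw x)).mul_real ((hasDerivAt_abs_rpow_mul hq (h x)).comp_hasGradientAt (hhg x))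
  have huh : ∀ x, gradient (fun y => u y * h y) x = u x • gradient h x + h x • gradient u x :=
    fun x => by rw [((hug x).mul_real (hhg x)).gradient, (hug x).gradient]
  have huh1 : ContDiff ℝ 1 fun y => u y * h y := hu1.mul hh1
  have huhs : HasCompactSupport fun y => u y * h y := hus.mul_right
  have hgu := hu1.continuous_gradient
  have hgh := hh1.continuous_gradient
  have I₁ : Integrable (fun x => mdot (A x + C x) (gradient u x) (gradient h x)) μ := by
    have hc : Continuous fun x => mdot (A x + C x) (gradient u x) (gradient h x) :=
      continuous_mdot (fun i j => (hAc i j).add (hCc i j)) hgu hgh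
    refine hc.integrable_of_hasCompactSupport (hus.gradient.mono fun x hx h0 => hx ?_)
    simp [mdot, h0]
  have I₂ : Integrable (fun x => ⟪Bb x, gradient u x⟫ * h x) μ := by
    have := integrable_inner_of_hasCompactSupport hBmeas hBloc (hh1.continuous.smul hgu)
      hus.gradient.smul_left
    refine this.congr (Filter.Eventually.of_forall fun x => ?_)
    simp [inner_smul_right, mul_comm]
  have I₃ : Integrable (fun x => u x * h x) μ :=
    huh1.continuous.integrable_of_hasCompactSupport huhs
  have I₄ : Integrable (fun x => ⟪Bb x, gradient (fun y => u y * h y) x⟫) μ :=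
    integrable_inner_of_hasCompactSupport hBmeas hBloc huh1.continuous_gradient huhs.gradient
  have I₅ : Integrable (fun x => φ x ^ 2 * |h x| ^ q) μ :=
    Continuous.integrable_of_hasCompactSupport
      ((hφ.continuous.pow 2).mul (hh1.continuous.abs.rpow_const fun _ => Or.inr (by linarith)))
      (hφs.mono fun x hx h0 => hx (by simp [h0]))
  have J₁ : Integrable (fun x => 1 / 2 * mdot (A x + C x) (gradient u x) (gradient h x)
      + ⟪Bb x, gradient u x⟫ * h x) μ := (I₁.const_mul _).add I₂
  have J₂ : Integrable (fun x => 1 / 2 * mdot (A x + C x) (gradient u x) (gradient h x)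
      + ⟪Bb x, gradient u x⟫ * h x + u x * h x) μ := J₁.add I₃
  refine ⟨I₅, ?_⟩
  have hLip := ContDiff.lipschitzWith_of_hasCompactSupport hus hu1 one_ne_zero
  have hLip' := ContDiff.lipschitzWith_of_hasCompactSupport huhs huh1 one_ne_zero
  have hzero : ∫ x, (1 / 2 * mdot (A x + C x) (gradient u x) (gradient h x)
      + ⟪Bb x, gradient u x⟫ * h x + u x * h x
      - (q - 1) / q * ⟪Bb x, gradient (fun y => u y * h y) x⟫) ∂μ = 0 := by
    rw [integral_sub J₂ (I₄.const_mul _), integral_add J₁ I₃, integral_add (I₁.const_mul _) I₂,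
      integral_const_mul, integral_const_mul, hBdiv _ hLip' huhs, hres u hLip hus]
    simp
  have hle : ∫ x, (φ x ^ 2 * |h x| ^ q - ((1 + d ^ 4) * δ + δ') * |h x| ^ q) ∂μ ≤ 0 := by
    rw [← hzero]
    refine integral_mono_ae (I₅.sub (hhq.const_mul _)) (J₂.sub (I₄.const_mul _)) ?_
    filter_upwards [hbd] with x hx
    have := integrand_lower_bound hd (hAsymm x) (hApos x) (hCanti x) (η := h x) hq (hφ01 x).1
      (hφ01 x).2 (Real.rpow_nonneg (abs_nonneg (h x)) (q - 2)) hx.1 hx.2.1 hx.2.2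
      (hug x).gradient
    simp only [huh]
    rwa [abs_rpow_sub_two_mul_sq hq] at this
  rw [integral_sub I₅ (hhq.const_mul _), integral_const_mul] at hle
  linarith

end Energy

/-- Theorem 3.3: under the growth bound
`⟨Ax,x⟩/‖x‖² + |C|_∞² Φ_A⁻¹ + |⟨B̄,x⟩| log‖x‖ ≤ K (‖x‖ log‖x‖)²` outside a ball,
every `C¹` function `h` with `∫ |h|^q dμ < ∞` (`q ∈ [2,∞)`) satisfying the weak resolvent
identity vanishes identically. -/
theorem stmt2 {d : ℕ} (hd : 2 ≤ d)
    (ρ : EuclideanSpace ℝ (Fin d) → ℝ) (hρc : Continuous ρ) (hρ : ∀ x, 0 < ρ x)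
    (μ : Measure (EuclideanSpace ℝ (Fin d)))
    (hμ : μ = volume.withDensity fun x => ENNReal.ofReal (ρ x))
    (A C : EuclideanSpace ℝ (Fin d) → Matrix (Fin d) (Fin d) ℝ)
    (hAc : ∀ i j, Continuous fun x => A x i j)
    (hAsymm : ∀ x, (A x).IsSymm) (hApos : ∀ x, (A x).PosDef)
    (hCc : ∀ i j, Continuous fun x => C x i j)
    (hCanti : ∀ x, (C x).transpose = -(C x))
    (Bb : EuclideanSpace ℝ (Fin d) → EuclideanSpace ℝ (Fin d))
    (hBmeas : Measurable Bb)
    (hBloc : LocallyIntegrable (fun x => ‖Bb x‖) μ)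
    (hBdiv : ∀ f : EuclideanSpace ℝ (Fin d) → ℝ, (∃ K, LipschitzWith K f) →
      HasCompactSupport f → ∫ x, ⟪Bb x, gradient f x⟫ ∂μ = 0)
    (q : ℝ) (hq : 2 ≤ q)
    (K : ℝ) (hK : 0 < K) (N₀ : ℕ) (hN₀ : 2 ≤ N₀)
    (hgrowth : ∀ᵐ x ∂(volume : Measure (EuclideanSpace ℝ (Fin d))),
      (N₀ : ℝ) < ‖x‖ →
        mdot (A x) x x / ‖x‖ ^ 2 + matSup (C x) ^ 2 * (PhiA (A x))⁻¹
          + |⟪Bb x, x⟫| * Real.log ‖x‖ ≤ K * (‖x‖ * Real.log ‖x‖) ^ 2)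
    (h : EuclideanSpace ℝ (Fin d) → ℝ) (hh1 : ContDiff ℝ 1 h)
    (hhq : Integrable (fun x => |h x| ^ q) μ)
    (hres : WeakResolvent μ A C Bb h) :
    ∀ x, h x = 0 := by
  subst hμ
  set μ : Measure (EuclideanSpace ℝ (Fin d)) :=
    volume.withDensity fun x => ENNReal.ofReal (ρ x) with hμ
  have hd0 : 0 < d := by omega
  have : IsLocallyFiniteMeasure μ := IsLocallyFiniteMeasure.withDensity_ofReal hρc
  have hvol : volume ≪ μ := withDensity_absolutelyContinuous'
    hρc.measurable.ennreal_ofReal.aemeasurable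
    (Filter.Eventually.of_forall fun x => (ENNReal.ofReal_pos.2 (hρ x)).ne')
  have : μ.IsOpenPosMeasure := hvol.isOpenPosMeasure
  have hgrowthμ := (withDensity_absolutelyContinuous volume
    fun x => ENNReal.ofReal (ρ x)).ae_le hgrowth
  set I : ℝ := ∫ x, |h x| ^ q ∂μ
  have hball : ∀ R : ℝ, (N₀ : ℝ) ≤ R → ∀ ε > 0,
      ∫ x in Metric.ball 0 R, |h x| ^ q ∂μ ≤ ((1 + d ^ 4) * (K * ε ^ 2) + K * ε) * I := by
    intro R hR ε hε
    have hN2 : (2 : ℝ) ≤ N₀ := by exact_mod_cast hN₀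
    obtain ⟨φ, s, hφ, hφs, hφ01, hφR, hφg, hs0, hsε⟩ :=
      exists_loglog_cutoff (d := d) (hN2.trans hR) hε
    obtain ⟨hφint, hle⟩ := integral_sq_mul_abs_rpow_le hd0 hAc hAsymm hApos hCc hCanti hBmeas hBloc
      hBdiv hq hh1 hhq hres hφ hφs hφ01 hφg (δ := K * ε ^ 2) (δ' := K * ε) (by
        filter_upwards [hgrowthμ] with x hx
        rcases le_or_gt ‖x‖ R with hxR | hxR
        · rw [hs0 x hxR, zero_smul]
          refine ⟨?_, ?_, ?_⟩ <;> simp [mdot] <;> positivity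
        · exact growth_bounds hd0 (hApos x) hK.le (by linarith) (hsε x hxR)
            (hx (hR.trans_lt hxR)))
    calc ∫ x in Metric.ball 0 R, |h x| ^ q ∂μ
        = ∫ x in Metric.ball 0 R, φ x ^ 2 * |h x| ^ q ∂μ :=
          setIntegral_congr_fun measurableSet_ball fun x hx => by
            simp only [hφR x (mem_ball_zero_iff.1 hx).le, one_pow, one_mul]
      _ ≤ ∫ x, φ x ^ 2 * |h x| ^ q ∂μ := setIntegral_le_integral hφint
          (Filter.Eventually.of_forall fun x => by positivity)
      _ ≤ _ := hle
  have hcont : Continuous fun x => |h x| ^ q :=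
    hh1.continuous.abs.rpow_const fun _ => Or.inr (by linarith)
  intro x₀
  set R : ℝ := max N₀ (‖x₀‖ + 1)
  have hlim : Filter.Tendsto (fun ε : ℝ => ((1 + d ^ 4) * (K * ε ^ 2) + K * ε) * I)
      (nhdsWithin 0 (Set.Ioi 0)) (nhds 0) := by
    have hc : Continuous fun ε : ℝ => ((1 + (d : ℝ) ^ 4) * (K * ε ^ 2) + K * ε) * I := by fun_prop
    simpa using (hc.tendsto 0).mono_left nhdsWithin_le_nhds
  have hR0 : ∫ x in Metric.ball 0 R, |h x| ^ q ∂μ ≤ 0 := ge_of_tendsto hlim (by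
    filter_upwards [self_mem_nhdsWithin] with ε hε
    exact hball R (le_max_left _ _) ε hε)
  have hnn : ∀ x, 0 ≤ |h x| ^ q := fun x => by positivity
  have hae := (integral_eq_zero_iff_of_nonneg hnn hhq.integrableOn).1
    (hR0.antisymm (integral_nonneg hnn))
  have hx₀ : |h x₀| ^ q = 0 := Measure.eqOn_open_of_ae_eq hae Metric.isOpen_ball
    hcont.continuousOn continuousOn_const
    (mem_ball_zero_iff.2 ((lt_add_one _).trans_le (le_max_right _ _)))
  exact abs_eq_zero.1 ((Real.rpow_eq_zero (abs_nonneg _) (by linarith)).1 hx₀)
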